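/- Fix a lexicographic order ≼ on the free group F = Fₘ, let ν ∈ F̂, and let H be a complex Hilbert space. If φ : Σ_ν → L(H) is a positive definite function, then φ has a positive definite extension Φ : F → L(H). -/

import Mathlib

namespace FreeGroupLex

variable {m : ℕ}

/-- The length of the longest common prefix of two lists. -/
def commonPrefixLen {α : Type*} [DecidableEq α] : List α → List α → ℕ
  | a :: as, b :: bs => if a = b then commonPrefixLen as bs + 1 else 0
  | _, _ => 0

/-- A strict total order `lt` on the free group `Fₘ` is *lexicographic* if:
(1) shorter (reduced) words come first; (2) words of equal length are compared by the
first letter (an element of `A ∪ A⁻¹`, i.e. a one-letter word) at which their reduced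
words differ. -/
def IsLexOrder (lt : FreeGroup (Fin m) → FreeGroup (Fin m) → Prop) : Prop :=
  IsStrictTotalOrder (FreeGroup (Fin m)) lt ∧
  (∀ s t : FreeGroup (Fin m), FreeGroup.norm s < FreeGroup.norm t → lt s t) ∧
  (∀ s t : FreeGroup (Fin m), FreeGroup.norm s = FreeGroup.norm t → s ≠ t →
    ∀ a b : Fin m × Bool,
      s.toWord[commonPrefixLen s.toWord t.toWord]? = some a →
      t.toWord[commonPrefixLen s.toWord t.toWord]? = some b →
      (lt s t ↔ lt (FreeGroup.mk [a]) (FreeGroup.mk [b])))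

/-- The induced order on `F̂ = F/{s ∼ s⁻¹}`: the class of `x` is `≼` the class of `y`
iff `min {x, x⁻¹} ≼ min {y, y⁻¹}`, written without choice via
`min {x,x⁻¹} ≼ min {y,y⁻¹} ↔ (x ≼ y ∨ x⁻¹ ≼ y) ∧ (x ≼ y⁻¹ ∨ x⁻¹ ≼ y⁻¹)`
(where `u ≼ v` means `lt u v ∨ u = v`). -/
def hatLe (lt : FreeGroup (Fin m) → FreeGroup (Fin m) → Prop)
    (x y : FreeGroup (Fin m)) : Prop :=
  ((lt x y ∨ x = y) ∨ (lt x⁻¹ y ∨ x⁻¹ = y)) ∧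
  ((lt x y⁻¹ ∨ x = y⁻¹) ∨ (lt x⁻¹ y⁻¹ ∨ x⁻¹ = y⁻¹))

/-- Strict version of `hatLe`: the class of `x` is strictly before the class of `y`. -/
def hatLt (lt : FreeGroup (Fin m) → FreeGroup (Fin m) → Prop)
    (x y : FreeGroup (Fin m)) : Prop :=
  hatLe lt x y ∧ ¬ hatLe lt y x

/-- Equality of classes in `F̂`, expressed via `hatLe`. -/
def hatEq (lt : FreeGroup (Fin m) → FreeGroup (Fin m) → Prop)
    (x y : FreeGroup (Fin m)) : Prop :=
  hatLe lt x y ∧ hatLe lt y x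

/-- The graph `Γ_ν` on the vertex set `F`: distinct `s, t` are adjacent iff the class of
`s⁻¹t` is `≼ ν` (the class of `ν`). -/
def Gamma (lt : FreeGroup (Fin m) → FreeGroup (Fin m) → Prop)
    (ν : FreeGroup (Fin m)) : SimpleGraph (FreeGroup (Fin m)) where
  Adj s t := s ≠ t ∧ hatLe lt (s⁻¹ * t) ν
  symm := by
    constructor
    rintro s t ⟨h1, h2⟩
    refine ⟨h1.symm, ?_⟩
    have e : t⁻¹ * s = (s⁻¹ * t)⁻¹ := by group
    rw [e]
    unfold hatLe at h2 ⊢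
    rw [inv_inv]
    tauto
  loopless := by constructor; rintro s ⟨h, -⟩; exact h rfl

/-- `Σ_ν = ⋃_{ν' ≼ ν} ν'`: the set of elements of `F` whose class in `F̂` is `≼` the
class of `ν`. -/
def Sigma' (lt : FreeGroup (Fin m) → FreeGroup (Fin m) → Prop)
    (ν : FreeGroup (Fin m)) : Set (FreeGroup (Fin m)) :=
  {x | hatLe lt x ν}

open scoped ComplexOrder in
/-- A function `φ` (with relevant values on a symmetric subset `S` of the free group) is
*positive definite on `S`* if for every finite family `s₁, …, s_k ∈ S` with
`sᵢ⁻¹sⱼ ∈ S` for all `i, j`, the block operator matrix `[φ(sᵢ⁻¹sⱼ)]` is positive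
semidefinite. -/
def IsPosDefOn {H : Type*} [NormedAddCommGroup H] [InnerProductSpace ℂ H]
    (S : Set (FreeGroup (Fin m))) (φ : FreeGroup (Fin m) → H →L[ℂ] H) : Prop :=
  ∀ (k : ℕ) (s : Fin k → FreeGroup (Fin m)), (∀ i, s i ∈ S) →
    (∀ i j, (s i)⁻¹ * s j ∈ S) → ∀ h : Fin k → H,
    0 ≤ ∑ i, ∑ j, (inner ℂ (h i) (φ ((s i)⁻¹ * s j) (h j)) : ℂ)
open FreeGroup in
lemma reduced_invRev {α : Type*} [DecidableEq α] {L : List (α × Bool)} (h : IsReduced L) :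
    IsReduced (invRev L) := by
  rw [isReduced_iff_reduce_eq] at *
  rw [reduce_invRev, h]

open FreeGroup in
lemma toWord_mk_of_reduced {α : Type*} [DecidableEq α] {L : List (α × Bool)} (h : IsReduced L) :
    (mk L).toWord = L := by
  rw [toWord_mk, h.reduce_eq]

lemma cpl_decomp {α : Type*} [DecidableEq α] (l₁ l₂ : List α) :
    ∃ p r t, l₁ = p ++ r ∧ l₂ = p ++ t ∧ p.length = commonPrefixLen l₁ l₂ ∧
      ∀ a ∈ r.head?, ∀ b ∈ t.head?, a ≠ b := by
  induction l₁ generalizing l₂ with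
  | nil => exact ⟨[], [], l₂, by simp [commonPrefixLen]⟩
  | cons a l ih =>
    cases l₂ with
    | nil => exact ⟨[], a :: l, [], by simp [commonPrefixLen]⟩
    | cons b l' =>
      by_cases hab : a = b
      · subst hab
        obtain ⟨p, r, t, h1, h2, h3, h4⟩ := ih l'
        exact ⟨a :: p, r, t, by simp [h1], by simp [h2], by simp [commonPrefixLen, h3], h4⟩
      · exact ⟨[], a :: l, b :: l', by simp [commonPrefixLen, hab]⟩

open FreeGroup in
lemma reduced_append {α : Type*} [DecidableEq α] {r t : List (α × Bool)}
    (hr : IsReduced r) (ht : IsReduced t) (h : ∀ a ∈ r.head?, ∀ b ∈ t.head?, a ≠ b) :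
    IsReduced (invRev r ++ t) := by
  have hr' := reduced_invRev hr
  unfold FreeGroup.IsReduced at *
  rw [List.isChain_append]
  refine ⟨hr', ht, ?_⟩
  intro x hx y hy hxy
  simp only [invRev, List.getLast?_reverse, List.head?_map, Option.mem_def,
    Option.map_eq_some_iff] at hx
  obtain ⟨a, ha, rfl⟩ := hx
  have := h a ha y hy
  rcases a with ⟨a1, a2⟩
  rcases y with ⟨y1, y2⟩
  simp only at hxy
  subst hxy
  cases a2 <;> cases y2 <;> simp_all

open FreeGroup in
lemma decomp {α : Type*} [DecidableEq α] (a b : FreeGroup α) :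
    ∃ p r t, a.toWord = p ++ r ∧ b.toWord = p ++ t ∧
      p.length = commonPrefixLen a.toWord b.toWord ∧
      (a⁻¹ * b).toWord = invRev r ++ t := by
  obtain ⟨p, r, t, h1, h2, h3, h4⟩ := cpl_decomp a.toWord b.toWord
  refine ⟨p, r, t, h1, h2, h3, ?_⟩
  have hr : IsReduced r := by
    have := isReduced_toWord (x := a)
    rw [h1] at this
    exact (List.isChain_append.1 this).2.1
  have ht : IsReduced t := by
    have := isReduced_toWord (x := b)
    rw [h2] at this
    exact (List.isChain_append.1 this).2.1
  have : a⁻¹ * b = mk (invRev r ++ t) := by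
    rw [← mk_toWord (x := a), ← mk_toWord (x := b), h1, h2, ← mul_mk, ← mul_mk, ← mul_mk, ← inv_mk]
    group
  rw [this, toWord_mk_of_reduced (reduced_append hr ht h4)]

open FreeGroup in
lemma norm_cpl {α : Type*} [DecidableEq α] (a b : FreeGroup α) :
    norm (a⁻¹ * b) + 2 * commonPrefixLen a.toWord b.toWord = norm a + norm b := by
  obtain ⟨p, r, t, h1, h2, h3, h4⟩ := decomp a b
  rw [← h3]
  simp only [FreeGroup.norm, h4, h1, h2, List.length_append, invRev_length]
  omega

lemma cpl_comm {α : Type*} [DecidableEq α] (a b : List α) :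
    commonPrefixLen a b = commonPrefixLen b a := by
  induction a generalizing b with
  | nil => cases b <;> simp [commonPrefixLen]
  | cons x a ih =>
    cases b with
    | nil => simp [commonPrefixLen]
    | cons y b => simp only [commonPrefixLen, eq_comm, ih]

lemma cpl_ultra {α : Type*} [DecidableEq α] (a b c : List α) :
    min (commonPrefixLen a b) (commonPrefixLen b c) ≤ commonPrefixLen a c := by
  induction a generalizing b c with
  | nil => cases b <;> simp [commonPrefixLen]
  | cons x a ih =>
    cases b with
    | nil => simp [commonPrefixLen]
    | cons y b =>
      cases c with
      | nil => simp [commonPrefixLen]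
      | cons z c =>
        have := ih b c
        simp only [commonPrefixLen]
        split_ifs <;> simp_all

open FreeGroup in
lemma norm_sq_gt {α : Type*} [DecidableEq α] (s : FreeGroup α) (hs : s ≠ 1) :
    norm s < norm (s * s) := by
  have h := reduceCyclically.reduce_flatten_replicate_succ (isReduced_toWord (x := s)) 1
  have h0 := reduceCyclically.conj_conjugator_reduceCyclically s.toWord
  have e : (s * s).toWord = reduce (List.replicate (1 + 1) s.toWord).flatten := by
    rw [toWord_mul]; simp [List.replicate]
  rw [h] at e
  have hne : reduceCyclically s.toWord ≠ [] := by
    intro hc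
    apply hs
    rw [← mk_toWord (x := s), ← h0, hc]
    simp only [List.append_nil, ← mul_mk, ← inv_mk, mul_inv_cancel]
  have := List.length_pos_iff.2 hne
  have e2 := congrArg List.length h0
  simp only [FreeGroup.norm, e]
  simp [List.replicate] at e2 ⊢
  omega

/-- letter relation -/
def ltr (lt : FreeGroup (Fin m) → FreeGroup (Fin m) → Prop) (a b : Fin m × Bool) : Prop :=
  lt (FreeGroup.mk [a]) (FreeGroup.mk [b])

lemma ltr_sto {lt : FreeGroup (Fin m) → FreeGroup (Fin m) → Prop} (hlt : IsLexOrder lt) :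
    IsStrictTotalOrder (Fin m × Bool) (ltr lt) := by
  have := hlt.1
  have hinj : Function.Injective (fun a : Fin m × Bool => FreeGroup.mk [a]) := by
    intro a b h
    have := congrArg FreeGroup.toWord h
    simpa [FreeGroup.toWord_mk, FreeGroup.reduce_singleton] using this
  exact (RelEmbedding.isStrictTotalOrder (s := lt)
    (⟨⟨fun a => FreeGroup.mk [a], hinj⟩, Iff.rfl⟩ : (ltr lt) ↪r lt))

lemma lt_iff_lex {lt : FreeGroup (Fin m) → FreeGroup (Fin m) → Prop} (hlt : IsLexOrder lt)
    (s t : FreeGroup (Fin m)) (hn : s.norm = t.norm) :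
    lt s t ↔ List.Lex (ltr lt) s.toWord t.toWord := by
  have := hlt.1
  have := ltr_sto hlt
  by_cases hst : s = t
  · subst hst
    constructor
    · intro h; exact absurd h (irrefl s)
    · intro h; exact absurd h (List.lex_irrefl (fun x => irrefl x) _)
  obtain ⟨p, r, u, h1, h2, h3, h4⟩ := cpl_decomp s.toWord t.toWord
  have hl : r.length = u.length := by
    simp only [FreeGroup.norm, h1, h2, List.length_append] at hn
    omega
  cases r with
  | nil =>
    have : u = [] := by simpa using hl.symm
    subst this
    exact absurd (FreeGroup.toWord_injective (h1.trans h2.symm)) hst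
  | cons a r =>
    cases u with
    | nil => simp at hl
    | cons b u =>
      have hab : a ≠ b := h4 a (by simp) b (by simp)
      have key := hlt.2.2 s t hn hst a b (by rw [← h3, h1]; simp) (by rw [← h3, h2]; simp)
      rw [key, h1, h2]
      constructor
      · intro h; exact List.Lex.append_left _ (List.Lex.rel (r := ltr lt) h) _
      · intro h
        have h' : List.Lex (ltr lt) (a :: r) (b :: u) := by
          clear h1 h2 h3
          induction p with
          | nil => exact h
          | cons c p ih => exact ih ((List.lex_cons_iff).1 h)
        rcases List.cons_lex_cons_iff.1 h' with h' | h'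
        · exact h'
        · exact absurd h'.1 hab

lemma lex_append_of {α : Type*} {r : α → α → Prop} {p q : List α} (h : List.Lex r p q)
    (hl : p.length = q.length) (x y : List α) : List.Lex r (p ++ x) (q ++ y) := by
  induction h with
  | nil => simp at hl
  | cons _ ih => exact List.Lex.cons (ih (by simpa using hl))
  | rel h => exact List.Lex.rel h

lemma lex_prefix_eq {α : Type*} {r : α → α → Prop} [IsStrictTotalOrder α r] {P Q : List α}
    (hl : P.length = Q.length) {x y x' y' : List α} (h1 : List.Lex r (P ++ x) (Q ++ y))
    (h2 : List.Lex r (Q ++ y') (P ++ x')) : P = Q := by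
  rcases trichotomous_of (List.Lex r) P Q with h | h | h
  · exact absurd h2 (asymm_of (List.Lex r) (lex_append_of h hl x' y'))
  · exact h
  · exact absurd h1 (asymm_of (List.Lex r) (lex_append_of h hl.symm y x))

open FreeGroup in
lemma word_lemma {α : Type*} [DecidableEq α] {p q g l : List (α × Bool)}
    (hg : FreeGroup.IsReduced g)
    (h1 : p.length ≤ q.length) (h2 : q.length ≤ p.length + g.length)
    (h : q ++ g = p ++ invRev g ++ l) : ∃ k, q = p ++ k ∧ g = invRev k := by
  rw [List.append_assoc] at h
  obtain ⟨k, hk⟩ : p <+: q := List.prefix_of_prefix_length_le ⟨_, h.symm⟩ ⟨_, rfl⟩ h1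
  subst hk
  refine ⟨k, rfl, ?_⟩
  rw [List.append_assoc, List.append_cancel_left_eq] at h
  obtain ⟨j, hj⟩ : k <+: invRev g :=
    List.prefix_of_prefix_length_le ⟨_, rfl⟩ ⟨_, h.symm⟩ (by simp at h2 ⊢; omega)
  have hg' : g = invRev j ++ invRev k := by
    rw [← invRev_append, hj, invRev_invRev]
  rw [← hj, hg', List.append_assoc, List.append_cancel_left_eq] at h
  have hjj : invRev j = j := List.append_inj_left h (by simp)
  have hmj : mk j = 1 := by
    have e : mk j * mk j = 1 := by
      nth_rewrite 1 [← hjj]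
      rw [← inv_mk, inv_mul_cancel]
    rw [← pow_two] at e
    exact (pow_eq_one_iff_left (two_ne_zero)).1 e
  have hjr : FreeGroup.IsReduced j := by
    rw [hg', hjj] at hg
    exact (List.isChain_append.1 hg).1
  have : j = [] := by
    rw [← toWord_mk_of_reduced hjr, hmj]; simp
  subst this
  simpa using hg'

section core
variable {lt : FreeGroup (Fin m) → FreeGroup (Fin m) → Prop}

lemma not_hatLe (hlt : IsLexOrder lt) {x y : FreeGroup (Fin m)} (h : ¬ hatLe lt y x) :
    (lt x y ∧ lt x y⁻¹) ∨ (lt x⁻¹ y ∧ lt x⁻¹ y⁻¹) := by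
  have := hlt.1
  have tri : ∀ a b, ¬ (lt a b ∨ a = b) → lt b a := by
    intro a b hab
    rcases trichotomous_of lt a b with h | h | h <;> tauto
  unfold hatLe at h
  rw [not_and_or, not_or, not_or (p := lt y x⁻¹ ∨ y = x⁻¹)] at h
  rcases h with ⟨h1, h2⟩ | ⟨h1, h2⟩
  · exact Or.inl ⟨tri _ _ h1, tri _ _ h2⟩
  · exact Or.inr ⟨tri _ _ h1, tri _ _ h2⟩

open FreeGroup in
lemma core_aux (hlt : IsLexOrder lt) {A B C D : FreeGroup (Fin m)}
    {u v g r t : List (Fin m × Bool)}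
    (hA : A.toWord = u ++ g ++ r) (hB : B.toWord = u ++ g ++ t)
    (hC : C.toWord = v ++ g ++ r) (hD : D.toWord = v ++ g ++ t)
    (huv : u.length = v.length) (hrt : r.length = t.length)
    (hu : u.length ≤ g.length + r.length) (hr : r.length ≤ g.length + u.length)
    (hne : r ≠ t) (hlex : List.Lex (ltr lt) u v)
    (AB : ¬ hatLe lt B A) (DB : ¬ hatLe lt B D) (DC : ¬ hatLe lt C D) : False := by
  have := hlt.1
  have := ltr_sto hlt
  have nA : A.norm = B.norm := by simp [FreeGroup.norm, hA, hB, hrt]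
  have nC : C.norm = B.norm := by simp [FreeGroup.norm, hC, hB, hrt, huv]
  have nD : D.norm = B.norm := by simp [FreeGroup.norm, hD, hB, huv]
  have tr : ∀ {x y z}, lt x y → lt y z → lt x z := fun h1 h2 => trans_of lt h1 h2
  have ir : ∀ {x}, ¬ lt x x := fun {x} => irrefl_of lt x
  have BD : lt B D := by
    rw [lt_iff_lex hlt _ _ nD.symm, hB, hD, List.append_assoc, List.append_assoc]
    exact lex_append_of hlex huv _ _
  have DB' : lt D⁻¹ B ∧ lt D⁻¹ B⁻¹ := by
    rcases not_hatLe hlt DB with h | h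
    · exact absurd (tr h.1 BD) ir
    · exact h
  have hne' : invRev r ≠ invRev t := fun h => hne (invRev_injective h)
  rcases trichotomous_of (List.Lex (ltr lt)) (invRev r) (invRev t) with h | h | h
  · have CD' : lt C⁻¹ D⁻¹ := by
      rw [lt_iff_lex hlt _ _ (by simp [norm_inv_eq, nC, nD]), toWord_inv, toWord_inv, hC, hD,
        invRev_append (L₂ := r), invRev_append (L₂ := t)]
      exact lex_append_of h (by simp [hrt]) _ _
    rcases not_hatLe hlt DC with h | h
    · exact ir (tr (tr (tr CD' DB'.1) BD) h.2)
    · exact ir (tr CD' h.2)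
  · exact hne' h
  · have BA' : lt B⁻¹ A⁻¹ := by
      rw [lt_iff_lex hlt _ _ (by simp [norm_inv_eq, nA]), toWord_inv, toWord_inv, hB, hA,
        invRev_append (L₂ := t), invRev_append (L₂ := r)]
      exact lex_append_of h (by simp [hrt]) _ _
    have AB' : lt A B⁻¹ := by
      rcases not_hatLe hlt AB with h | h
      · exact h.2
      · exact absurd (tr BA' h.2) ir
    have l1 := (lt_iff_lex hlt _ _ (by simp [norm_inv_eq, nA])).1 AB'
    have l2 := (lt_iff_lex hlt _ _ (by simp [norm_inv_eq, nD])).1 DB'.1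
    rw [toWord_inv, hA, hB, invRev_append, invRev_append, ← List.append_assoc] at l1
    rw [toWord_inv, hD, hB, invRev_append, invRev_append, ← List.append_assoc] at l2
    have hg : FreeGroup.IsReduced g := by
      have := isReduced_toWord (x := A)
      rw [hA] at this
      exact (List.isChain_append.1 (List.isChain_append.1 this).1).2.1
    have hB1 : B = 1 := by
      rcases le_total t.length u.length with hle | hle
      · have e := List.take_append_drop (t.length + g.length) (u ++ g)
        rw [← e, List.append_assoc] at l1
        rw [← e, List.append_assoc (List.take _ _)] at l2
        have := lex_prefix_eq (by simp; omega) l1 l2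
        rw [this] at e
        obtain ⟨k, hk1, hk2⟩ := word_lemma hg (by simpa using hle) (by simp; omega) e.symm
        rw [← mk_toWord (x := B), hB, hk1, hk2]
        simp only [← mul_mk, ← inv_mk]
        group
      · have e := List.take_append_drop (u.length + g.length) (invRev t ++ invRev g)
        rw [← e, List.append_assoc (List.take _ _)] at l1
        rw [← e, List.append_assoc] at l2
        have := lex_prefix_eq (by simp; omega) l1 l2
        rw [← this] at e
        obtain ⟨k, hk1, hk2⟩ := word_lemma (p := u) (q := invRev t) (g := invRev g)
          (reduced_invRev hg) (by simpa using hle) (by simp; omega)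
          (by rw [invRev_invRev]; exact e.symm)
        have hk2 := invRev_injective hk2
        have hk1 := congrArg invRev hk1
        rw [invRev_invRev] at hk1
        rw [← mk_toWord (x := B), hB, hk1, hk2, invRev_append]
        simp only [← mul_mk, ← inv_mk]
        group
    rw [hB1] at hB
    have ht : t = [] := by simp at hB; tauto
    have : r = [] := by rw [ht] at hrt; simpa using hrt
    exact hne (by rw [ht, this])

open FreeGroup in
lemma common_suffix {α : Type*} [DecidableEq α] (a b : FreeGroup α) :
    ∃ g u v, a.toWord = u ++ g ∧ b.toWord = v ++ g ∧
      (a * b⁻¹).toWord = u ++ invRev v := by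
  obtain ⟨p, r, t, h1, h2, -, h4⟩ := decomp a⁻¹ b⁻¹
  rw [toWord_inv] at h1 h2
  refine ⟨invRev p, invRev r, invRev t, ?_, ?_, ?_⟩
  · rw [← invRev_append, ← h1, invRev_invRev]
  · rw [← invRev_append, ← h2, invRev_invRev]
  · simpa using h4

open FreeGroup in
lemma core (hlt : IsLexOrder lt) {A B C D : FreeGroup (Fin m)} {N : ℕ}
    (nA : A.norm = N) (nB : B.norm = N) (nC : C.norm = N) (nD : D.norm = N)
    (e : A⁻¹ * B = C⁻¹ * D) (h1 : (A⁻¹ * B).norm ≤ N) (h2 : (A * C⁻¹).norm ≤ N)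
    (AB : ¬ hatLe lt B A) (AC : ¬ hatLe lt C A)
    (DB : ¬ hatLe lt B D) (DC : ¬ hatLe lt C D) : False := by
  have := ltr_sto hlt
  obtain ⟨p, r, t, a1, a2, -, a4⟩ := decomp A B
  obtain ⟨p', r', t', b1, b2, -, b4⟩ := decomp C D
  simp only [FreeGroup.norm] at *
  rw [a4, List.length_append, invRev_length] at h1
  have la := congrArg List.length a1
  have lb := congrArg List.length a2
  have lc := congrArg List.length b1
  have ld := congrArg List.length b2
  rw [List.length_append] at la lb lc ld
  rw [e, b4] at a4
  have le := congrArg List.length a4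
  simp only [List.length_append, invRev_length] at le
  obtain ⟨er, et⟩ := List.append_inj a4 (by simp; omega)
  have er := invRev_injective er
  subst er et
  have hpr : FreeGroup.IsReduced p := by
    have := isReduced_toWord (x := A)
    rw [a1] at this
    exact (List.isChain_append.1 this).1
  have hpr' : FreeGroup.IsReduced p' := by
    have := isReduced_toWord (x := C)
    rw [b1] at this
    exact (List.isChain_append.1 this).1
  obtain ⟨g, u, v, c1, c2, c3⟩ := common_suffix (mk p) (mk p')
  rw [toWord_mk_of_reduced hpr] at c1
  rw [toWord_mk_of_reduced hpr'] at c2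
  have e2 : A * C⁻¹ = mk p * (mk p')⁻¹ := by
    rw [← mk_toWord (x := A), ← mk_toWord (x := C), a1, b1, ← mul_mk, ← mul_mk]
    group
  rw [e2, c3, List.length_append, invRev_length] at h2
  subst c1 c2
  simp only [List.length_append] at la lb lc ld
  have huv : u.length = v.length := by omega
  have hrt : r'.length = t'.length := by omega
  have hne : r' ≠ t' := by
    rintro rfl
    have : A = B := toWord_injective (by rw [a1, a2])
    subst this
    exact AB (by unfold hatLe; tauto)
  rcases trichotomous_of (List.Lex (ltr lt)) u v with h | h | h
  · exact core_aux hlt a1 a2 b1 b2 huv hrt (by omega) (by omega) hne h AB DB DC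
  · subst h
    have : A = C := toWord_injective (by rw [a1, b1])
    subst this
    exact AC (by unfold hatLe; tauto)
  · exact core_aux hlt b2 b1 a2 a1 huv.symm hrt.symm (by omega) (by omega) hne.symm h DC AC AB

/-- down-closed sets for the order of classes -/
def DownClosed (lt : FreeGroup (Fin m) → FreeGroup (Fin m) → Prop)
    (S : Set (FreeGroup (Fin m))) : Prop :=
  ∀ x ∈ S, ∀ y, hatLe lt y x → y ∈ S

lemma DownClosed.inv {S : Set (FreeGroup (Fin m))} (hS : DownClosed lt S)
    {x : FreeGroup (Fin m)} (hx : x ∈ S) : x⁻¹ ∈ S :=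
  hS x hx _ (by unfold hatLe; simp)

lemma DownClosed.norm_le (hlt : IsLexOrder lt) {S : Set (FreeGroup (Fin m))}
    (hS : DownClosed lt S) {x y : FreeGroup (Fin m)} (hx : x ∈ S) (hy : y ∉ S) :
    x.norm ≤ y.norm := by
  by_contra! h
  refine hy (hS x hx y ?_)
  have h' : y.norm < x⁻¹.norm := by simpa using h
  exact ⟨Or.inl (Or.inl (hlt.2.1 _ _ h)), Or.inl (Or.inl (hlt.2.1 _ _ h'))⟩

open FreeGroup in
lemma four_aux (hlt : IsLexOrder lt) {S : Set (FreeGroup (Fin m))}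
    (hS : DownClosed lt S) {a b c : FreeGroup (Fin m)} (ha : a ∈ S) (hab : a⁻¹ * b ∈ S)
    (hbc : b⁻¹ * c ∈ S) (hc : c ∈ S) (hb : b ∉ S) (hac : a⁻¹ * c ∉ S)
    (hle : commonPrefixLen a.toWord b.toWord ≤ commonPrefixLen b.toWord c.toWord) : False := by
  have n1 := norm_cpl a b
  have n2 := norm_cpl b c
  have n3 := norm_cpl a c
  have n4 := cpl_ultra a.toWord b.toWord c.toWord
  have m1 := hS.norm_le hlt ha hb
  have m2 := hS.norm_le hlt hc hb
  have m3 := hS.norm_le hlt hab hb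
  have m4 := hS.norm_le hlt hbc hb
  have m5 := hS.norm_le hlt ha hac
  have m6 := hS.norm_le hlt hc hac
  have m7 := hS.norm_le hlt hab hac
  have m8 := hS.norm_le hlt hbc hac
  rw [min_eq_left hle] at n4
  have nh : ∀ {x y}, x ∈ S → y ∉ S → ¬ hatLe lt y x := fun hx hy h => hy (hS _ hx _ h)
  -- sides: c, b, a⁻¹c, a⁻¹b of maximal length
  refine core hlt (A := c) (B := b) (C := a⁻¹ * c) (D := a⁻¹ * b) (N := b.norm)
    (by omega) rfl (by omega) (by omega) (by group) ?_ ?_ (nh hc hb) (nh hc hac)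
    (nh hab hb) (nh hab hac)
  · have : c⁻¹ * b = (b⁻¹ * c)⁻¹ := by group
    rw [this, norm_inv_eq]; exact m4
  · have : c * (a⁻¹ * c)⁻¹ = a := by group
    rw [this]; exact m1

lemma four_cycle (hlt : IsLexOrder lt) {S : Set (FreeGroup (Fin m))}
    (hS : DownClosed lt S) {a b c : FreeGroup (Fin m)} (ha : a ∈ S) (hab : a⁻¹ * b ∈ S)
    (hbc : b⁻¹ * c ∈ S) (hc : c ∈ S) (hb : b ∉ S) : a⁻¹ * c ∈ S := by
  by_contra hac
  have iv : ∀ x y : FreeGroup (Fin m), x⁻¹ * y ∈ S → y⁻¹ * x ∈ S := by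
    intro x y h
    have := hS.inv h
    simpa using this
  rcases le_total (commonPrefixLen a.toWord b.toWord) (commonPrefixLen b.toWord c.toWord) with h | h
  · exact four_aux hlt hS ha hab hbc hc hb hac h
  · refine four_aux hlt hS hc (iv _ _ hbc) (iv _ _ hab) ha hb (fun h => hac (iv _ _ h)) ?_
    rw [cpl_comm c.toWord, cpl_comm b.toWord a.toWord]; exact h

end core

section operators
variable {H : Type*} [NormedAddCommGroup H] [InnerProductSpace ℂ H] [CompleteSpace H]

open UniformSpace in
lemma exists_beta {E : Type*} [SeminormedAddCommGroup E] [InnerProductSpace ℂ E]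
    (γ : E →ₗ[ℂ] H) (P : H →L[ℂ] H)
    (hP : ∀ h x, 0 ≤ (inner ℂ h (P h)).re + 2 * (inner ℂ h (γ x)).re + (inner ℂ x x).re) :
    ∃ β : H →L[ℂ] Completion E, (∀ h (x : E), inner ℂ (β h) (x : Completion E) = inner ℂ h (γ x)) ∧
      ∀ h, ‖β h‖ ^ 2 ≤ (inner ℂ h (P h)).re := by
  have hb : ∀ x, ‖γ x‖ ≤ Real.sqrt ‖P‖ * ‖x‖ := by
    intro x
    have key : ∀ s : ℝ, 0 ≤ ‖x‖ ^ 2 * (s * s) + (-2 * ‖γ x‖ ^ 2) * s + ‖P‖ * ‖γ x‖ ^ 2 := by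
      intro s
      have h1 := hP (γ x) ((-s : ℂ) • x)
      have h2 : (inner ℂ (γ x) (P (γ x))).re ≤ ‖P‖ * ‖γ x‖ ^ 2 := by
        calc (inner ℂ (γ x) (P (γ x))).re ≤ ‖γ x‖ * ‖P (γ x)‖ := re_inner_le_norm (𝕜 := ℂ) _ _
          _ ≤ ‖γ x‖ * (‖P‖ * ‖γ x‖) := by gcongr; exact P.le_opNorm _
          _ = _ := by ring
      have h3 : inner ℂ (γ x) (γ x) = ((‖γ x‖ ^ 2 : ℝ) : ℂ) := by
        simp [inner_self_eq_norm_sq_to_K]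
      have h4 : inner ℂ x x = ((‖x‖ ^ 2 : ℝ) : ℂ) := by
        simp [inner_self_eq_norm_sq_to_K]
      simp only [map_smul, inner_smul_right, inner_smul_left, h3, h4] at h1
      simp only [← Complex.ofReal_neg, Complex.conj_ofReal, ← Complex.ofReal_mul,
        Complex.ofReal_re] at h1
      nlinarith
    have hd := discrim_le_zero key
    unfold discrim at hd
    rcases eq_or_ne (‖γ x‖) 0 with h0 | h0
    · rw [h0]; positivity
    have hpos : 0 < ‖γ x‖ ^ 2 := by positivity
    have : ‖γ x‖ ^ 2 ≤ ‖P‖ * ‖x‖ ^ 2 := by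
      have : ‖γ x‖ ^ 2 * ‖γ x‖ ^ 2 ≤ ‖γ x‖ ^ 2 * (‖P‖ * ‖x‖ ^ 2) := by nlinarith
      exact le_of_mul_le_mul_left this hpos
    have h5 := Real.sqrt_le_sqrt this
    rwa [Real.sqrt_sq (norm_nonneg _), Real.sqrt_mul (norm_nonneg _),
      Real.sqrt_sq (norm_nonneg _)] at h5
  let γc : E →L[ℂ] H := γ.mkContinuous _ hb
  let γe : Completion E →L[ℂ] H := γc.extend (Completion.toComplL (𝕜 := ℂ))
  have hγe : ∀ x : E, γe (x : Completion E) = γ x := by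
    intro x
    exact ContinuousLinearMap.extend_eq γc (Completion.denseRange_coe)
      (Completion.isUniformInducing_coe E) x
  refine ⟨ContinuousLinearMap.adjoint γe, ?_, ?_⟩
  · intro h x
    rw [ContinuousLinearMap.adjoint_inner_left, hγe]
  · intro h
    have key : ∀ k : Completion E,
        0 ≤ (inner ℂ h (P h)).re + 2 * (inner ℂ h (γe k)).re + (inner ℂ k k).re := by
      intro k
      induction k using Completion.induction_on with
      | hp =>
        apply isClosed_le continuous_const
        fun_prop
      | ih x =>
        rw [hγe, Completion.inner_coe]
        exact hP h x
    have := key (-(ContinuousLinearMap.adjoint γe h))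
    rw [← ContinuousLinearMap.adjoint_inner_left γe] at this
    simp only [inner_neg_right, inner_neg_left, neg_neg] at this
    have h3 : inner ℂ (ContinuousLinearMap.adjoint γe h) (ContinuousLinearMap.adjoint γe h)
      = ((‖ContinuousLinearMap.adjoint γe h‖ ^ 2 : ℝ) : ℂ) := by
        simp [inner_self_eq_norm_sq_to_K]
    rw [h3] at this
    simp only [Complex.neg_re, Complex.ofReal_re] at this
    linarith

open UniformSpace in
lemma exists_X {E : Type*} [SeminormedAddCommGroup E] [InnerProductSpace ℂ E]
    (γ δ : E →ₗ[ℂ] H) (P Q : H →L[ℂ] H)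
    (hP : ∀ h x, 0 ≤ (inner ℂ h (P h)).re + 2 * (inner ℂ h (γ x)).re + (inner ℂ x x).re)
    (hQ : ∀ h x, 0 ≤ (inner ℂ h (Q h)).re + 2 * (inner ℂ h (δ x)).re + (inner ℂ x x).re) :
    ∃ X : H →L[ℂ] H, ∀ h k x, 0 ≤ (inner ℂ h (P h)).re + (inner ℂ k (Q k)).re +
      (inner ℂ x x).re + 2 * (inner ℂ h (γ x)).re + 2 * (inner ℂ k (δ x)).re
      + 2 * (inner ℂ h (X k)).re := by
  obtain ⟨β, b1, b2⟩ := exists_beta γ P hP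
  obtain ⟨ε, e1, e2⟩ := exists_beta δ Q hQ
  refine ⟨(ContinuousLinearMap.adjoint β) ∘L ε, fun h k x => ?_⟩
  rw [ContinuousLinearMap.comp_apply, ContinuousLinearMap.adjoint_inner_right, ← b1, ← e1,
    ← Completion.inner_coe x x]
  have h0 : 0 ≤ (inner ℂ (β h + ε k + (x : Completion E)) (β h + ε k + (x : Completion E))).re :=
    inner_self_nonneg (𝕜 := ℂ)
  have sq : ∀ z : Completion E, (inner ℂ z z).re = ‖z‖ ^ 2 := fun z =>
    (norm_sq_eq_re_inner (𝕜 := ℂ) z).symm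
  have sm : ∀ y z : Completion E, (inner ℂ y z).re = (inner ℂ z y).re := fun y z =>
    inner_re_symm (𝕜 := ℂ) y z
  simp only [inner_add_left, inner_add_right, Complex.add_re] at h0
  rw [sq (β h), sq (ε k), sm (ε k) (β h), sm (x : Completion E) (β h),
    sm (x : Completion E) (ε k)] at h0
  have := b2 h
  have := e2 k
  linarith

end operators

section pd
variable {H : Type*} [NormedAddCommGroup H] [InnerProductSpace ℂ H]

/-- quadratic form -/
noncomputable def quad (φ : FreeGroup (Fin m) → H →L[ℂ] H) (K : Finset (FreeGroup (Fin m)))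
    (x y : FreeGroup (Fin m) → H) : ℂ :=
  ∑ a ∈ K, ∑ b ∈ K, inner ℂ (x a) (φ (a⁻¹ * b) (y b))

/-- finset version of positive definiteness -/
def PD (S : Set (FreeGroup (Fin m))) (φ : FreeGroup (Fin m) → H →L[ℂ] H) : Prop :=
  (∀ x ∈ S, ∀ h k, inner ℂ h (φ x⁻¹ k) = inner ℂ (φ x h) k) ∧
  ∀ K : Finset (FreeGroup (Fin m)), (∀ x ∈ K, ∀ y ∈ K, x⁻¹ * y ∈ S) →
    ∀ h : FreeGroup (Fin m) → H, 0 ≤ (quad φ K h h).re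

lemma quad_conj {φ : FreeGroup (Fin m) → H →L[ℂ] H} {K : Finset (FreeGroup (Fin m))}
    (herm : ∀ a ∈ K, ∀ b ∈ K, ∀ h k,
      inner ℂ h (φ (a⁻¹ * b)⁻¹ k) = inner ℂ (φ (a⁻¹ * b) h) k)
    (x y : FreeGroup (Fin m) → H) : (starRingEnd ℂ) (quad φ K y x) = quad φ K x y := by
  unfold quad
  simp only [map_sum]
  rw [Finset.sum_comm]
  refine Finset.sum_congr rfl fun a ha => Finset.sum_congr rfl fun b hb => ?_
  rw [inner_conj_symm, ← herm b hb a ha]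
  simp

lemma quad_insert {φ : FreeGroup (Fin m) → H →L[ℂ] H} {K : Finset (FreeGroup (Fin m))}
    {p : FreeGroup (Fin m)} (hp : p ∉ K)
    (herm : ∀ c ∈ K, ∀ h k, inner ℂ h (φ (c⁻¹ * p) k) = inner ℂ (φ (p⁻¹ * c) h) k)
    (h : FreeGroup (Fin m) → H) :
    (quad φ (insert p K) h h).re = (inner ℂ (h p) (φ 1 (h p))).re +
      2 * (inner ℂ (h p) (∑ c ∈ K, φ (p⁻¹ * c) (h c))).re + (quad φ K h h).re := by
  unfold quad
  rw [Finset.sum_insert hp, Finset.sum_insert hp]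
  simp only [Finset.sum_insert hp, Finset.sum_add_distrib, inner_sum, inv_mul_cancel]
  have : ∑ a ∈ K, inner ℂ (h a) (φ (a⁻¹ * p) (h p)) =
      (starRingEnd ℂ) (∑ c ∈ K, inner ℂ (h p) (φ (p⁻¹ * c) (h c))) := by
    rw [map_sum]
    refine Finset.sum_congr rfl fun a ha => ?_
    rw [herm a ha, inner_conj_symm]
  rw [this]
  simp only [Complex.add_re, Complex.conj_re]
  ring

lemma quad_congr {φ ψ : FreeGroup (Fin m) → H →L[ℂ] H} {K : Finset (FreeGroup (Fin m))}
    {x y : FreeGroup (Fin m) → H}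
    (hφ : ∀ a ∈ K, ∀ b ∈ K, φ (a⁻¹ * b) = ψ (a⁻¹ * b)) (hxy : ∀ a ∈ K, x a = y a) :
    quad φ K x x = quad ψ K y y :=
  Finset.sum_congr rfl fun a ha => Finset.sum_congr rfl fun b hb => by
    rw [hφ a ha b hb, hxy a ha, hxy b hb]

lemma quad_mono {φ : FreeGroup (Fin m) → H →L[ℂ] H} {K C : Finset (FreeGroup (Fin m))}
    (hKC : K ⊆ C) {x : FreeGroup (Fin m) → H} (hx : ∀ a ∈ C, a ∉ K → x a = 0) :
    quad φ K x x = quad φ C x x := by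
  unfold quad
  rw [Finset.sum_subset hKC]
  · refine Finset.sum_congr rfl fun a ha => ?_
    refine Finset.sum_subset hKC fun b hb hb' => ?_
    rw [hx b hb hb']; simp
  · intro a ha ha'
    rw [hx a ha ha']; simp

lemma quad_translate (φ : FreeGroup (Fin m) → H →L[ℂ] H) (K : Finset (FreeGroup (Fin m)))
    (g : FreeGroup (Fin m)) (h : FreeGroup (Fin m) → H) :
    quad φ (K.image (g * ·)) (fun z => h (g⁻¹ * z)) (fun z => h (g⁻¹ * z)) = quad φ K h h := by
  unfold quad
  have hi : Set.InjOn (g * ·) (K : Set (FreeGroup (Fin m))) := (mul_right_injective g).injOn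
  rw [Finset.sum_image hi]
  refine Finset.sum_congr rfl fun a _ => ?_
  rw [Finset.sum_image hi]
  refine Finset.sum_congr rfl fun b _ => ?_
  simp

lemma posDef_of_PD {S : Set (FreeGroup (Fin m))} {φ : FreeGroup (Fin m) → H →L[ℂ] H}
    (h : PD S φ) : IsPosDefOn S φ := by
  intro k s _ hs v
  classical
  let K := Finset.univ.image s
  let w : FreeGroup (Fin m) → H := fun x => ∑ i with s i = x, v i
  have e : ∑ i, ∑ j, (inner ℂ (v i) (φ ((s i)⁻¹ * s j) (v j)) : ℂ) = quad φ K w w := by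
    unfold quad
    simp only [w, sum_inner, map_sum, inner_sum]
    have hm : ∀ i ∈ (Finset.univ : Finset (Fin k)), s i ∈ K := fun i _ =>
      Finset.mem_image_of_mem _ (Finset.mem_univ i)
    refine (Finset.sum_fiberwise_of_maps_to hm _).symm.trans ?_
    refine Finset.sum_congr rfl fun a _ => ?_
    rw [Finset.sum_comm]
    refine (Finset.sum_fiberwise_of_maps_to hm _).symm.trans ?_
    refine Finset.sum_congr rfl fun b _ => Finset.sum_congr rfl fun j hj => ?_
    refine Finset.sum_congr rfl fun i hi => ?_
    rw [(Finset.mem_filter.1 hi).2, (Finset.mem_filter.1 hj).2]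
  have hK : ∀ x ∈ K, ∀ y ∈ K, x⁻¹ * y ∈ S := by
    intro x hx y hy
    obtain ⟨i, -, rfl⟩ := Finset.mem_image.1 hx
    obtain ⟨j, -, rfl⟩ := Finset.mem_image.1 hy
    exact hs i j
  rw [e, Complex.nonneg_iff]
  refine ⟨h.2 K hK w, ?_⟩
  have := quad_conj (φ := φ) (K := K) (fun a ha b hb => h.1 _ (hK a ha b hb)) w w
  have := congrArg Complex.im this
  rw [Complex.conj_im] at this
  linarith

lemma PD_of_posDef {S : Set (FreeGroup (Fin m))} {φ : FreeGroup (Fin m) → H →L[ℂ] H}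
    (h1 : (1 : FreeGroup (Fin m)) ∈ S) (hinv : ∀ x ∈ S, x⁻¹ ∈ S)
    (h : IsPosDefOn S φ) : PD S φ := by
  constructor
  · intro x hx v w
    have r1 : ∀ v : H, (inner ℂ v (φ 1 v)).im = 0 := by
      intro v
      have := h 1 (fun _ => 1) (fun _ => h1) (fun _ _ => by simpa using h1) (fun _ => v)
      rw [Complex.nonneg_iff] at this
      simpa using this.2.symm
    have r2 : ∀ v w : H, (inner ℂ v (φ x⁻¹ w)).im + (inner ℂ w (φ x v)).im = 0 := by
      intro v w
      have := h 2 ![x, 1] (by intro i; fin_cases i <;> simp [h1, hx])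
        (by intro i j; fin_cases i <;> fin_cases j <;> simp [h1, hx, hinv]) ![v, w]
      rw [Complex.nonneg_iff] at this
      have := this.2
      simp [Fin.sum_univ_two, r1] at this
      linarith
    have a1 := r2 v w
    have a2 := r2 v (Complex.I • w)
    simp at a2
    rw [← inner_conj_symm (φ x v) w]
    apply Complex.ext
    · rw [Complex.conj_re]; linarith
    · rw [Complex.conj_im]; linarith
  · intro K hK v
    rcases K.eq_empty_or_nonempty with rfl | ⟨x, hx⟩
    · simp [quad]
    let s : Fin K.card → FreeGroup (Fin m) := fun i => x⁻¹ * (K.equivFin.symm i : FreeGroup (Fin m))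
    have hs : ∀ i j, (s i)⁻¹ * s j =
        (K.equivFin.symm i : FreeGroup (Fin m))⁻¹ * (K.equivFin.symm j : FreeGroup (Fin m)) := by
      intro i j; simp only [s]; group
    have := h K.card s (fun i => hK x hx _ (K.equivFin.symm i).2)
      (fun i j => by rw [hs]; exact hK _ (K.equivFin.symm i).2 _ (K.equivFin.symm j).2)
      (fun i => v (K.equivFin.symm i))
    simp only [hs] at this
    rw [Complex.nonneg_iff] at this
    convert this.1 using 2
    unfold quad
    rw [← Finset.sum_coe_sort K, ← K.equivFin.symm.sum_comp]
    refine Finset.sum_congr rfl fun i _ => ?_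
    rw [← Finset.sum_coe_sort K, ← K.equivFin.symm.sum_comp]

end pd

section step
variable {H : Type*} [NormedAddCommGroup H] [InnerProductSpace ℂ H] [CompleteSpace H]
variable {lt : FreeGroup (Fin m) → FreeGroup (Fin m) → Prop}

lemma finite_norm_le (n : ℕ) : {x : FreeGroup (Fin m) | x.norm ≤ n}.Finite := by
  have := List.finite_length_le (Fin m × Bool) n
  exact Set.Finite.of_finite_image (f := FreeGroup.toWord)
    (this.subset (by rintro _ ⟨x, hx, rfl⟩; exact hx)) FreeGroup.toWord_injective.injOn

/-- The pre-inner product attached to a clique. -/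
noncomputable def cliqueCore {S : Set (FreeGroup (Fin m))} {φ : FreeGroup (Fin m) → H →L[ℂ] H}
    (h : PD S φ) (C : Finset (FreeGroup (Fin m))) (hC : ∀ x ∈ C, ∀ y ∈ C, x⁻¹ * y ∈ S) :
    PreInnerProductSpace.Core ℂ (FreeGroup (Fin m) → H) where
  inner x y := quad φ C x y
  conj_inner_symm x y := quad_conj (fun a ha b hb => h.1 _ (hC a ha b hb)) x y
  re_inner_nonneg x := h.2 C hC x
  add_left x y z := by simp [quad, inner_add_left, Finset.sum_add_distrib]
  smul_left x y r := by simp [quad, inner_smul_left, Finset.mul_sum, mul_comm]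

lemma exists_X_clique {S : Set (FreeGroup (Fin m))} {φ : FreeGroup (Fin m) → H →L[ℂ] H}
    (h : PD S φ) (C : Finset (FreeGroup (Fin m))) (hC : ∀ x ∈ C, ∀ y ∈ C, x⁻¹ * y ∈ S)
    (γ δ : (FreeGroup (Fin m) → H) →ₗ[ℂ] H) (P Q : H →L[ℂ] H)
    (hP : ∀ h x, 0 ≤ (inner ℂ h (P h)).re + 2 * (inner ℂ h (γ x)).re + (quad φ C x x).re)
    (hQ : ∀ h x, 0 ≤ (inner ℂ h (Q h)).re + 2 * (inner ℂ h (δ x)).re + (quad φ C x x).re) :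
    ∃ X : H →L[ℂ] H, ∀ h k x, 0 ≤ (inner ℂ h (P h)).re + (inner ℂ k (Q k)).re +
      (quad φ C x x).re + 2 * (inner ℂ h (γ x)).re + 2 * (inner ℂ k (δ x)).re
      + 2 * (inner ℂ h (X k)).re := by
  letI core := cliqueCore h C hC
  letI i1 : SeminormedAddCommGroup (FreeGroup (Fin m) → H) :=
    @InnerProductSpace.Core.toSeminormedAddCommGroup ℂ _ _ _ _ core
  letI i2 : InnerProductSpace ℂ (FreeGroup (Fin m) → H) := InnerProductSpace.ofCore core
  exact exists_X γ δ P Q hP hQ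

lemma bordered {S : Set (FreeGroup (Fin m))} {φ : FreeGroup (Fin m) → H →L[ℂ] H}
    (h : PD S φ) {C : Finset (FreeGroup (Fin m))} {p : FreeGroup (Fin m)} (hp : p ∉ C)
    (hC : ∀ x ∈ insert p C, ∀ y ∈ insert p C, x⁻¹ * y ∈ S) (v : H)
    (x : FreeGroup (Fin m) → H) :
    0 ≤ (inner ℂ v (φ 1 v)).re + 2 * (inner ℂ v (∑ c ∈ C, φ (p⁻¹ * c) (x c))).re
      + (quad φ C x x).re := by
  classical
  have h0 := h.2 (insert p C) hC (Function.update x p v)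
  have hne : ∀ c ∈ C, Function.update x p v c = x c := fun c hc =>
    Function.update_of_ne (by rintro rfl; exact hp hc) _ _
  rw [quad_insert hp] at h0
  · rw [quad_congr (fun _ _ _ _ => rfl) hne, Function.update_self] at h0
    rwa [Finset.sum_congr rfl (fun c hc => by rw [hne c hc])] at h0
  · intro c hc v w
    rw [← h.1 _ (hC p (by simp) c (by simp [hc]))]
    simp

lemma step (hlt : IsLexOrder lt) {S : Set (FreeGroup (Fin m))} (hS : DownClosed lt S)
    (h1 : (1 : FreeGroup (Fin m)) ∈ S) {s : FreeGroup (Fin m)} (hs : s ∉ S)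
    {φ : FreeGroup (Fin m) → H →L[ℂ] H} (h : PD S φ) :
    ∃ ψ : FreeGroup (Fin m) → H →L[ℂ] H, PD (S ∪ {s, s⁻¹}) ψ ∧ Set.EqOn ψ φ S := by
  classical
  have hs1 : s ≠ 1 := fun e => hs (e ▸ h1)
  have hsi : s⁻¹ ∉ S := fun e => hs (by simpa using hS.inv e)
  have hnorm := norm_sq_gt s hs1
  have hss : s ≠ s⁻¹ := by
    intro e
    have : s * s = 1 := by nth_rewrite 1 [e]; simp
    rw [this] at hnorm
    simp at hnorm
  have hsq : s * s ∉ S ∪ {s, s⁻¹} := by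
    rintro (hx | hx | hx)
    · have := hS.norm_le hlt hx hs
      omega
    · rw [hx] at hnorm; omega
    · rw [hx, FreeGroup.norm_inv_eq] at hnorm; omega
  have hfin : {c : FreeGroup (Fin m) | c ∈ S ∧ c⁻¹ * s ∈ S}.Finite :=
    (finite_norm_le s.norm).subset fun c hc => hS.norm_le hlt hc.1 hs
  let C := hfin.toFinset
  have memC : ∀ c, c ∈ C ↔ c ∈ S ∧ c⁻¹ * s ∈ S := fun c => by simp [C]
  have iv : ∀ x y : FreeGroup (Fin m), x⁻¹ * y ∈ S → y⁻¹ * x ∈ S := by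
    intro x y h
    have := hS.inv h
    simpa using this
  have hC : ∀ x ∈ C, ∀ y ∈ C, x⁻¹ * y ∈ S := by
    intro x hx y hy
    rw [memC] at hx hy
    exact four_cycle hlt hS hx.1 hx.2 (iv _ _ hy.2) hy.1 hs
  have h1C : (1 : FreeGroup (Fin m)) ∉ C := by
    rw [memC]; rintro ⟨-, h⟩; exact hs (by simpa using h)
  have hsC : s ∉ C := by
    rw [memC]; rintro ⟨h, -⟩; exact hs h
  have hC1 : ∀ x ∈ insert 1 C, ∀ y ∈ insert 1 C, x⁻¹ * y ∈ S := by
    intro x hx y hy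
    rcases Finset.mem_insert.1 hx with rfl | hx <;> rcases Finset.mem_insert.1 hy with rfl | hy
    · simpa using h1
    · simpa using ((memC y).1 hy).1
    · simpa using hS.inv ((memC x).1 hx).1
    · exact hC x hx y hy
  have hCs : ∀ x ∈ insert s C, ∀ y ∈ insert s C, x⁻¹ * y ∈ S := by
    intro x hx y hy
    rcases Finset.mem_insert.1 hx with rfl | hx <;> rcases Finset.mem_insert.1 hy with rfl | hy
    · simpa using h1
    · exact iv _ _ ((memC y).1 hy).2
    · exact ((memC x).1 hx).2
    · exact hC x hx y hy
  let γ : FreeGroup (Fin m) → (FreeGroup (Fin m) → H) →ₗ[ℂ] H := fun p =>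
    ∑ c ∈ C, (φ (p⁻¹ * c)).toLinearMap ∘ₗ LinearMap.proj c
  have hγ : ∀ p x, γ p x = ∑ c ∈ C, φ (p⁻¹ * c) (x c) := by
    intro p x; simp [γ]
  obtain ⟨X, hX⟩ := exists_X_clique h C hC (γ 1) (γ s) (φ 1) (φ 1)
    (fun v x => by rw [hγ]; exact bordered h h1C hC1 v x)
    (fun v x => by rw [hγ]; exact bordered h hsC hCs v x)
  let ψ : FreeGroup (Fin m) → H →L[ℂ] H := fun z =>
    if z = s then X else if z = s⁻¹ then ContinuousLinearMap.adjoint X else φ z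
  have ψs : ψ s = X := by simp [ψ]
  have ψsi : ψ s⁻¹ = ContinuousLinearMap.adjoint X := by simp [ψ, hss.symm]
  have ψS : Set.EqOn ψ φ S := by
    intro z hz
    have e1 : z ≠ s := fun e => hs (e ▸ hz)
    have e2 : z ≠ s⁻¹ := fun e => hsi (e ▸ hz)
    simp [ψ, e1, e2]
  have herm : ∀ x ∈ S ∪ {s, s⁻¹}, ∀ h k, inner ℂ h (ψ x⁻¹ k) = inner ℂ (ψ x h) k := by
    rintro x (hx | rfl | rfl) v w
    · rw [ψS hx, ψS (hS.inv hx)]; exact h.1 x hx v w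
    · rw [ψs, ψsi, ContinuousLinearMap.adjoint_inner_right]
    · rw [inv_inv, ψs, ψsi, ContinuousLinearMap.adjoint_inner_left]
  -- normalized cliques
  have main : ∀ K : Finset (FreeGroup (Fin m)), (∀ x ∈ K, ∀ y ∈ K, x⁻¹ * y ∈ S ∪ {s, s⁻¹}) →
      1 ∈ K → s ∈ K → ∀ v : FreeGroup (Fin m) → H, 0 ≤ (quad ψ K v v).re := by
    intro K hK K1 Ks v
    let K0 := (K.erase 1).erase s
    have hK0 : ∀ c ∈ K0, c ∈ K ∧ c ≠ 1 ∧ c ≠ s := by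
      intro c hc; simp only [K0, Finset.mem_erase] at hc; tauto
    have hsub : K0 ⊆ C := by
      intro c hc
      obtain ⟨cK, c1, cs⟩ := hK0 c hc
      rw [memC]
      have a1 := hK 1 K1 c cK
      have a2 := hK c cK s Ks
      rw [inv_one, one_mul] at a1
      constructor
      · rcases a1 with a1 | a1 | a1
        · exact a1
        · exact absurd a1 cs
        · rw [Set.mem_singleton_iff] at a1
          subst a1
          rw [inv_inv] at a2
          exact absurd a2 hsq
      · rcases a2 with a2 | a2 | a2
        · exact a2
        · exact absurd (by simpa using a2) c1
        · have : c = s * s := by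
            have a2 : c⁻¹ * s = s⁻¹ := a2
            rw [inv_mul_eq_iff_eq_mul, eq_mul_inv_iff_mul_eq] at a2
            exact a2.symm
          exact absurd (this ▸ a1) hsq
    have eK : K = insert 1 (insert s K0) := by
      rw [Finset.insert_erase, Finset.insert_erase K1]
      exact Finset.mem_erase.2 ⟨hs1, Ks⟩
    have n1 : (1 : FreeGroup (Fin m)) ∉ insert s K0 := by
      simp [K0, hs1.symm]
    have n2 : s ∉ K0 := by simp [K0]
    let x : FreeGroup (Fin m) → H := fun c => if c ∈ K0 then v c else 0
    have x0 : ∀ c ∈ K0, x c = v c := fun c hc => by simp [x, hc]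
    have x1 : ∀ c, c ∉ K0 → x c = 0 := fun c hc => by simp [x, hc]
    have q0 : quad ψ K0 v v = quad φ C x x := by
      rw [← quad_mono hsub (fun a _ ha => x1 a ha)]
      exact quad_congr (fun a ha b hb => ψS (hC a (hsub ha) b (hsub hb)))
        (fun a ha => (x0 a ha).symm)
    have g0 : ∀ p, (∀ c ∈ C, p⁻¹ * c ∈ S) →
        ∑ c ∈ K0, ψ (p⁻¹ * c) (v c) = γ p x := by
      intro p hp
      rw [hγ, ← Finset.sum_subset hsub]
      · refine Finset.sum_congr rfl fun c hc => ?_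
        rw [ψS (hp c (hsub hc)), x0 c hc]
      · intro c _ hc
        rw [x1 c hc]; simp
    have hh : ∀ p ∈ K, ∀ c ∈ K, ∀ h k,
        inner ℂ h (ψ (c⁻¹ * p) k) = inner ℂ (ψ (p⁻¹ * c) h) k := by
      intro p hp c hc v w
      rw [← herm _ (hK p hp c hc)]
      simp
    rw [eK, quad_insert n1, quad_insert n2, Finset.sum_insert n2, q0,
      g0 1 (fun c hc => hC1 1 (by simp) c (by simp [hc])),
      g0 s (fun c hc => hCs s (by simp) c (by simp [hc])), inv_one, one_mul, ψs, ψS h1,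
      inner_add_right, Complex.add_re]
    · have := hX (v 1) (v s) x
      linarith
    · intro c hc
      exact hh s Ks c (hK0 c hc).1
    · intro c hc
      exact hh 1 K1 c (by rw [eK]; exact Finset.mem_insert_of_mem hc)
  refine ⟨ψ, ⟨herm, ?_⟩, ψS⟩
  intro K hK v
  by_cases hall : ∀ x ∈ K, ∀ y ∈ K, x⁻¹ * y ∈ S
  · rw [quad_congr (ψ := φ) (y := v) (fun a ha b hb => ψS (hall a ha b hb)) (fun _ _ => rfl)]
    exact h.2 K hall v
  have : ∃ x ∈ K, ∃ y ∈ K, x⁻¹ * y = s := by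
    push Not at hall
    obtain ⟨x, hx, y, hy, hxy⟩ := hall
    rcases hK x hx y hy with e | e | e
    · exact absurd e hxy
    · exact ⟨x, hx, y, hy, e⟩
    · refine ⟨y, hy, x, hx, ?_⟩
      have e : x⁻¹ * y = s⁻¹ := e
      rw [← inv_inj, ← e]; simp
  obtain ⟨x, hx, y, hy, hxy⟩ := this
  rw [← quad_translate ψ K x⁻¹ v]
  refine main _ ?_ ?_ ?_ _
  · intro a ha b hb
    obtain ⟨c, hc, rfl⟩ := Finset.mem_image.1 ha
    obtain ⟨d, hd, rfl⟩ := Finset.mem_image.1 hb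
    have : (x⁻¹ * c)⁻¹ * (x⁻¹ * d) = c⁻¹ * d := by group
    simp only [this]
    exact hK c hc d hd
  · exact Finset.mem_image.2 ⟨x, hx, by simp⟩
  · exact Finset.mem_image.2 ⟨y, hy, hxy⟩

end step

section final
variable {lt : FreeGroup (Fin m) → FreeGroup (Fin m) → Prop}

lemma Sigma_downClosed (hlt : IsLexOrder lt) (ν : FreeGroup (Fin m)) :
    DownClosed lt (Sigma' lt ν) := by
  have := hlt.1
  have tr : ∀ {a b c}, lt a b → lt b c → lt a c := fun h1 h2 => _root_.trans h1 h2
  intro x hx y hy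
  have key : ∀ z, ((lt x z ∨ x = z) ∨ (lt x⁻¹ z ∨ x⁻¹ = z)) →
      ((lt y z ∨ y = z) ∨ (lt y⁻¹ z ∨ y⁻¹ = z)) := by
    intro z hz
    have tr' : ∀ w, ((lt y w ∨ y = w) ∨ (lt y⁻¹ w ∨ y⁻¹ = w)) → (lt w z ∨ w = z) →
        ((lt y z ∨ y = z) ∨ (lt y⁻¹ z ∨ y⁻¹ = z)) := by
      rintro w hw (h | rfl)
      · rcases hw with (h' | rfl) | (h' | rfl)
        · exact Or.inl (Or.inl (tr h' h))
        · exact Or.inl (Or.inl h)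
        · exact Or.inr (Or.inl (tr h' h))
        · exact Or.inr (Or.inl h)
      · exact hw
    rcases hz with hz | hz
    · exact tr' x hy.1 hz
    · exact tr' x⁻¹ hy.2 hz
  exact ⟨key _ hx.1, key _ hx.2⟩

lemma one_mem_Sigma (hlt : IsLexOrder lt) (ν : FreeGroup (Fin m)) :
    (1 : FreeGroup (Fin m)) ∈ Sigma' lt ν := by
  have key : ∀ z : FreeGroup (Fin m), lt 1 z ∨ 1 = z := by
    intro z
    by_cases hz : z = 1
    · exact Or.inr hz.symm
    · refine Or.inl (hlt.2.1 _ _ ?_)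
      rw [FreeGroup.norm_one]
      exact Nat.pos_of_ne_zero fun h => hz (FreeGroup.norm_eq_zero.1 h)
  exact ⟨Or.inl (key _), Or.inl (key _)⟩

lemma exists_next (hlt : IsLexOrder lt) {S : Set (FreeGroup (Fin m))} (hS : DownClosed lt S)
    (hne : S ≠ Set.univ) : ∃ s, s ∉ S ∧ DownClosed lt (S ∪ {s, s⁻¹}) := by
  have := hlt.1
  obtain ⟨y0, hy0⟩ := (Set.ne_univ_iff_exists_notMem S).1 hne
  have hfin : {x : FreeGroup (Fin m) | x ∉ S ∧ x.norm ≤ y0.norm}.Finite :=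
    (finite_norm_le y0.norm).subset fun x hx => hx.2
  have hwf : Set.WellFoundedOn {x : FreeGroup (Fin m) | x ∉ S ∧ x.norm ≤ y0.norm} lt :=
    hfin.wellFoundedOn
  obtain ⟨⟨s, hsS, hsn⟩, -, hmin⟩ := hwf.has_min Set.univ ⟨⟨y0, hy0, le_rfl⟩, trivial⟩
  have hmin' : ∀ z, lt z s → z ∈ S := by
    intro z hz
    by_contra hzS
    have : z.norm ≤ s.norm := by
      by_contra! h
      exact asymm hz (hlt.2.1 _ _ h)
    exact hmin ⟨z, hzS, this.trans hsn⟩ trivial hz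
  refine ⟨s, hsS, ?_⟩
  have key : ∀ y, ((lt y s ∨ y = s) ∨ (lt y⁻¹ s ∨ y⁻¹ = s)) → y ∈ S ∪ {s, s⁻¹} := by
    rintro y ((h | rfl) | (h | rfl))
    · exact Or.inl (hmin' y h)
    · simp
    · have := hS.inv (hmin' _ h)
      rw [inv_inv] at this
      exact Or.inl this
    · simp
  rintro x (hx | rfl | rfl) y hy
  · exact Or.inl (hS x hx y hy)
  · exact key y hy.1
  · exact key y (by simpa using hy.2)

lemma chain_finite {α β : Type*} {f : α → Set β} {c : Set α} {r : α → α → Prop}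
    (hc : IsChain r c) (hr : ∀ a b, r a b → f a ⊆ f b) (hne : c.Nonempty)
    (T : Finset β) (hT : ∀ x ∈ T, ∃ a ∈ c, x ∈ f a) : ∃ a ∈ c, ∀ x ∈ T, x ∈ f a := by
  classical
  induction T using Finset.induction_on with
  | empty => obtain ⟨a, ha⟩ := hne; exact ⟨a, ha, by simp⟩
  | insert x T _ ih =>
    obtain ⟨a, ha, h1⟩ := ih fun y hy => hT y (Finset.mem_insert_of_mem hy)
    obtain ⟨b, hb, h2⟩ := hT x (Finset.mem_insert_self _ _)
    have : f a ⊆ f b ∨ f b ⊆ f a := by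
      by_cases e : a = b
      · exact Or.inl (e ▸ subset_rfl)
      · exact (hc ha hb e).imp (hr _ _) (hr _ _)
    rcases this with h | h
    · refine ⟨b, hb, fun y hy => ?_⟩
      rcases Finset.mem_insert.1 hy with rfl | hy
      · exact h2
      · exact h (h1 y hy)
    · refine ⟨a, ha, fun y hy => ?_⟩
      rcases Finset.mem_insert.1 hy with rfl | hy
      · exact h h2
      · exact h1 y hy

lemma extension_aux {H : Type*} [NormedAddCommGroup H] [InnerProductSpace ℂ H]
    [CompleteSpace H] (hlt : IsLexOrder lt) {S₀ : Set (FreeGroup (Fin m))}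
    (hS₀ : DownClosed lt S₀) (h1 : (1 : FreeGroup (Fin m)) ∈ S₀)
    {φ : FreeGroup (Fin m) → H →L[ℂ] H} (hφ : PD S₀ φ) :
    ∃ Φ : FreeGroup (Fin m) → H →L[ℂ] H, PD Set.univ Φ ∧ Set.EqOn Φ φ S₀ := by
  classical
  let P := {p : Set (FreeGroup (Fin m)) × (FreeGroup (Fin m) → H →L[ℂ] H) //
    S₀ ⊆ p.1 ∧ DownClosed lt p.1 ∧ PD p.1 p.2 ∧ Set.EqOn p.2 φ S₀}
  let r : P → P → Prop := fun p q => p.1.1 ⊆ q.1.1 ∧ Set.EqOn q.1.2 p.1.2 p.1.1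
  have rtrans : ∀ {a b c : P}, r a b → r b c → r a c := by
    intro a b c hab hbc
    exact ⟨hab.1.trans hbc.1, fun x hx => (hbc.2 (hab.1 hx)).trans (hab.2 hx)⟩
  have hub : ∀ c : Set P, IsChain r c → ∃ ub : P, ∀ a ∈ c, r a ub := by
    intro c hc
    rcases c.eq_empty_or_nonempty with rfl | hne
    · exact ⟨⟨(S₀, φ), subset_rfl, hS₀, hφ, fun _ _ => rfl⟩, by simp⟩
    let S : Set (FreeGroup (Fin m)) := {x | ∃ a ∈ c, x ∈ a.1.1}
    let ψ : FreeGroup (Fin m) → H →L[ℂ] H := fun x =>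
      if h : ∃ a ∈ c, x ∈ a.1.1 then h.choose.1.2 x else 0
    have hψ : ∀ a ∈ c, Set.EqOn ψ a.1.2 a.1.1 := by
      intro a ha x hx
      have h : ∃ a ∈ c, x ∈ a.1.1 := ⟨a, ha, hx⟩
      have e : ψ x = h.choose.1.2 x := by simp only [ψ]; rw [dif_pos h]
      rw [e]
      obtain ⟨hb, hbx⟩ := h.choose_spec
      by_cases hab : a = h.choose
      · rw [← hab]
      · rcases hc ha hb hab with h' | h'
        · exact h'.2 hx
        · exact (h'.2 hbx).symm
    have hSD : DownClosed lt S := by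
      rintro x ⟨a, ha, hx⟩ y hy
      exact ⟨a, ha, a.2.2.1 x hx y hy⟩
    refine ⟨⟨(S, ψ), ?_, hSD, ⟨?_, ?_⟩, ?_⟩, ?_⟩
    · obtain ⟨a, ha⟩ := hne
      exact fun x hx => ⟨a, ha, a.2.1 hx⟩
    · rintro x ⟨a, ha, hx⟩ v w
      have := a.2.2.2.1.1 x hx v w
      rw [← hψ a ha hx, ← hψ a ha (a.2.2.1.inv hx)] at this
      exact this
    · intro K hK v
      obtain ⟨a, ha, haK⟩ := chain_finite (f := fun a : P => a.1.1) hc (fun _ _ h => h.1) hne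
        (Finset.image₂ (fun x y => x⁻¹ * y) K K) (by
          intro z hz
          obtain ⟨x, hx, y, hy, rfl⟩ := Finset.mem_image₂.1 hz
          exact hK x hx y hy)
      have haK' : ∀ x ∈ K, ∀ y ∈ K, x⁻¹ * y ∈ a.1.1 := fun x hx y hy =>
        haK _ (Finset.mem_image₂_of_mem hx hy)
      have := a.2.2.2.1.2 K haK' v
      rwa [quad_congr (ψ := ψ) (y := v) (fun x hx y hy => (hψ a ha (haK' x hx y hy)).symm)
        (fun _ _ => rfl)] at this
    · obtain ⟨a, ha⟩ := hne
      exact fun x hx => (hψ a ha (a.2.1 hx)).trans (a.2.2.2.2 hx)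
    · intro a ha
      exact ⟨fun x hx => ⟨a, ha, hx⟩, hψ a ha⟩
  obtain ⟨M, hM⟩ := exists_maximal_of_chains_bounded hub rtrans
  obtain ⟨⟨S, ψ⟩, hS0, hSD, hPD, hE⟩ := M
  have hu : S = Set.univ := by
    by_contra hne
    obtain ⟨s, hs, hsD⟩ := exists_next hlt hSD hne
    obtain ⟨ψ', hψ', hE'⟩ := step hlt hSD (hS0 h1) hs hPD
    have := hM ⟨(S ∪ {s, s⁻¹}, ψ'), hS0.trans Set.subset_union_left, hsD, hψ',
      fun x hx => (hE' (hS0 hx)).trans (hE hx)⟩ ⟨Set.subset_union_left, hE'⟩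
    exact hs (this.1 (by simp))
  subst hu
  exact ⟨ψ, hPD, hE⟩

end final

/-- Every positive definite `L(H)`-valued function on `Σ_ν` admits a
positive definite extension to the whole free group `F`. -/
theorem posDef_extension_of_Sigma {m : ℕ}
    {H : Type*} [NormedAddCommGroup H] [InnerProductSpace ℂ H] [CompleteSpace H]
    (lt : FreeGroup (Fin m) → FreeGroup (Fin m) → Prop) (hlt : IsLexOrder lt)
    (ν : FreeGroup (Fin m))
    (φ : FreeGroup (Fin m) → H →L[ℂ] H) (hφ : IsPosDefOn (Sigma' lt ν) φ) :
    ∃ Φ : FreeGroup (Fin m) → H →L[ℂ] H,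
      IsPosDefOn (Set.univ : Set (FreeGroup (Fin m))) Φ ∧ Set.EqOn Φ φ (Sigma' lt ν) := by
  obtain ⟨Φ, h, e⟩ := extension_aux hlt (Sigma_downClosed hlt ν) (one_mem_Sigma hlt ν)
    (PD_of_posDef (one_mem_Sigma hlt ν) (fun _ hx => (Sigma_downClosed hlt ν).inv hx) hφ)
  exact ⟨Φ, posDef_of_PD h, e⟩

end FreeGroupLex
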